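/- arXiv:math/0412214 — 2 statements merged into one kernel-verified Lean document; each statement's English description precedes it below -/
import Mathlib

section
/- Let (W,S) be a Coxeter system. Then any Coxeter element c = s_n⋯s_2s_1 of W (the product of all the elements of S in some linear order S = {s_1,…,s_n}) is essential; that is, c does not lie in any proper parabolic subgroup of W. -/
/-!
Statement 6 (Theorem 3.1): Let (W,S) be a Coxeter system. Then any Coxeter element
c = s_n ⋯ s_2 s_1 of W (the product of all the elements of S in some linear order) is
essential; that is, c does not lie in any proper parabolic subgroup of W.
-/

noncomputable section

namespace CoxeterPaper

variable {B : Type*} {W : Type*} [Group W]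

/-- The standard parabolic subgroup `W_X`, generated by the simple reflections indexed by `X`. -/
def standardParabolic {M : CoxeterMatrix B} (cs : CoxeterSystem M W) (X : Set B) : Subgroup W :=
  Subgroup.closure (cs.simple '' X)

/-- A parabolic subgroup of `W`: a conjugate `w W_X w⁻¹` of a standard parabolic subgroup. -/
def IsParabolic {M : CoxeterMatrix B} (cs : CoxeterSystem M W) (P : Subgroup W) : Prop :=
  ∃ (w : W) (X : Set B), P = (standardParabolic cs X).map (MulAut.conj w).toMonoidHom

/-- `w` is essential: it does not lie in any proper parabolic subgroup of `W`. -/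
def IsEssential {M : CoxeterMatrix B} (cs : CoxeterSystem M W) (w : W) : Prop :=
  ∀ P : Subgroup W, IsParabolic cs P → P ≠ ⊤ → w ∉ P

open Polynomial.Chebyshev in
/-- The product of two reflections pairing by `-2 cos (π / m)` has order dividing `m`. -/
theorem reflection_mul_reflection_pow_eq_one {V : Type*} [AddCommGroup V] [Module ℝ V]
    {x y : V} {f g : Module.Dual ℝ V} (hf : f x = 2) (hg : g y = 2) {m : ℕ} (hm : 2 ≤ m)
    (hfy : f y = -2 * Real.cos (Real.pi / m)) (hgx : g x = -2 * Real.cos (Real.pi / m)) :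
    (Module.reflection hf * Module.reflection hg) ^ m = 1 := by
  ext z
  obtain rfl | hm3 : m = 2 ∨ 3 ≤ m := by lia
  · have hfy0 : f y = 0 := by simp [hfy]
    have hgx0 : g x = 0 := by simp [hgx]
    simp only [pow_two, LinearEquiv.mul_apply, Module.reflection_apply, map_sub, map_smul, hf, hg,
      hfy0, hgx0, LinearEquiv.coe_one, id_eq]
    module
  have hm0 : (0 : ℝ) < m := by exact_mod_cast (by lia : 0 < m)
  set θ : ℝ := 2 * Real.pi / m with hθ
  have hmθ : m * θ = 2 * Real.pi := by rw [hθ]; field_simp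
  have ht : 2 * Real.cos θ = f y * g x - 2 := by
    rw [hfy, hgx, hθ, mul_div_assoc, Real.cos_two_mul]; ring
  have hsin : Real.sin θ ≠ 0 := by
    have hm3' : (3 : ℝ) ≤ m := by exact_mod_cast hm3
    refine (Real.sin_pos_of_pos_of_lt_pi (by positivity) ?_).ne'
    rw [hθ, div_lt_iff₀ hm0]
    nlinarith [Real.pi_pos]
  have hS (k : ℤ) : (S ℝ k).eval (2 * Real.cos θ) * Real.sin θ = Real.sin ((k + 1) * θ) :=
    S_two_mul_real_cos θ k
  rw [Module.reflection_mul_reflection_pow_apply hf hg m z _ ht]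
  obtain ⟨k, hk⟩ := Nat.even_or_odd' m
  obtain hk | hk := hk
  · have h0 : (S ℝ ((k : ℤ) - 1)).eval (2 * Real.cos θ) = 0 := by
      refine (mul_eq_zero.mp ?_).resolve_right hsin
      rw [hS, show ((((k : ℤ) - 1 : ℤ) : ℝ) + 1) * θ = Real.pi by
        push_cast
        rw [hk] at hmθ
        push_cast at hmθ
        linarith, Real.sin_pi]
    rw [show ((m : ℤ) - 2) / 2 = k - 1 by lia, show ((m : ℤ) - 1) / 2 = k - 1 by lia, h0]
    simp
  · have h0 : (S ℝ (k : ℤ)).eval (2 * Real.cos θ) + (S ℝ ((k : ℤ) - 1)).eval (2 * Real.cos θ)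
        = 0 := by
      refine (mul_eq_zero.mp ?_).resolve_right hsin
      rw [add_mul, hS, hS, show (((k : ℤ) : ℝ) + 1) * θ =
        2 * Real.pi - ((((k : ℤ) - 1 : ℤ) : ℝ) + 1) * θ by
          push_cast
          rw [hk] at hmθ
          push_cast at hmθ
          linarith, Real.sin_two_pi_sub]
      ring
    rw [show ((m : ℤ) - 2) / 2 = k - 1 by lia, show ((m : ℤ) - 1) / 2 = k by lia,
      show ((m : ℤ) - 3) / 2 = k - 1 by lia, show (m : ℤ) / 2 = k by lia, h0]
    simp

/-- The simple root indexed by `i`, in a space large enough for the simple roots and the simple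
coroots to be simultaneously linearly independent. -/
def simpleRoot (i : B) : (B → ℝ) × (B → ℝ) :=
  open Classical in (Pi.single i 1, 0)

/-- The simple coroot indexed by `i`, a linear form on the space containing the simple roots. -/
def simpleCoroot [Fintype B] (M : CoxeterMatrix B) (i : B) :
    Module.Dual ℝ ((B → ℝ) × (B → ℝ)) :=
  LinearMap.proj i ∘ₗ LinearMap.snd ℝ (B → ℝ) (B → ℝ) + LinearMap.proj i ∘ₗ
    (Matrix.of fun j k ↦ -2 * Real.cos (Real.pi / M j k)).mulVecLin ∘ₗ
      LinearMap.fst ℝ (B → ℝ) (B → ℝ)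

theorem simpleCoroot_simpleRoot [Fintype B] (M : CoxeterMatrix B) (i j : B) :
    simpleCoroot M i (simpleRoot j) = -2 * Real.cos (Real.pi / M i j) := by
  classical
  simp [simpleCoroot, simpleRoot, Pi.single_apply, Matrix.mulVec, dotProduct]

theorem simpleCoroot_simpleRoot_self [Fintype B] (M : CoxeterMatrix B) (i : B) :
    simpleCoroot M i (simpleRoot i) = 2 := by
  simp [simpleCoroot_simpleRoot]

theorem isLiftable_reflection [Fintype B] (M : CoxeterMatrix B) :
    M.IsLiftable fun i ↦ Module.reflection (simpleCoroot_simpleRoot_self M i) := by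
  intro i j
  obtain rfl | hij := eq_or_ne i j
  · ext1 v
    simpa using Module.involutive_reflection (simpleCoroot_simpleRoot_self M i) v
  obtain h0 | h2 : M i j = 0 ∨ 2 ≤ M i j := by have := M.off_diagonal i j hij; lia
  · rw [h0, pow_zero]
  · exact reflection_mul_reflection_pow_eq_one _ _ h2 (simpleCoroot_simpleRoot M i j)
      (by rw [simpleCoroot_simpleRoot, M.symmetric])

/-- The representation of `W` in which each simple reflection acts by the reflection in the
corresponding simple root. -/
def reflectionRep [Fintype B] {M : CoxeterMatrix B} (cs : CoxeterSystem M W) :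
    W →* (((B → ℝ) × (B → ℝ)) ≃ₗ[ℝ] ((B → ℝ) × (B → ℝ))) :=
  cs.lift ⟨_, isLiftable_reflection M⟩

theorem reflectionRep_simple_apply [Fintype B] {M : CoxeterMatrix B} (cs : CoxeterSystem M W)
    (i : B) (v : (B → ℝ) × (B → ℝ)) :
    reflectionRep cs (cs.simple i) v = v - simpleCoroot M i v • simpleRoot i := by
  rw [reflectionRep, cs.lift_apply_simple, Module.reflection_apply]

/-- An element of the subgroup generated by some simple reflections fixes every vector on which
the corresponding coroots vanish. -/
theorem reflectionRep_apply_eq_self [Fintype B] {M : CoxeterMatrix B} (cs : CoxeterSystem M W)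
    {X : Set B} {v : (B → ℝ) × (B → ℝ)} (hv : ∀ i ∈ X, simpleCoroot M i v = 0)
    {x : W} (hx : x ∈ standardParabolic cs X) : reflectionRep cs x v = v := by
  refine Subgroup.closure_induction (p := fun x _ ↦ reflectionRep cs x v = v) ?_ (by simp) ?_ ?_ hx
  · rintro _ ⟨i, hi, rfl⟩
    simp [reflectionRep_simple_apply, hv i hi]
  · intro x y _ _ hx hy
    rw [map_mul, LinearEquiv.mul_apply, hy, hx]
  · intro x _ hx
    nth_rewrite 1 [← hx]
    rw [← LinearEquiv.mul_apply, ← map_mul, inv_mul_cancel, map_one, LinearEquiv.coe_one, id_eq]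

theorem reflectionRep_prod_apply_fst_of_notMem [Fintype B] {M : CoxeterMatrix B}
    (cs : CoxeterSystem M W) {l : List B} {i : B} (hi : i ∉ l) (v : (B → ℝ) × (B → ℝ)) :
    (reflectionRep cs (l.map cs.simple).prod v).1 i = v.1 i := by
  induction l with
  | nil => simp
  | cons a l ih =>
    rw [List.mem_cons, not_or] at hi
    simp [reflectionRep_simple_apply, simpleRoot, ih hi.2, hi.1]

/-- A vector fixed by a product of distinct simple reflections is killed by each of the
corresponding coroots. -/
theorem simpleCoroot_eq_zero_of_reflectionRep_prod_apply_eq_self [Fintype B]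
    {M : CoxeterMatrix B} (cs : CoxeterSystem M W) {l : List B} (hnd : l.Nodup)
    {v : (B → ℝ) × (B → ℝ)} (hv : reflectionRep cs (l.map cs.simple).prod v = v) :
    ∀ i ∈ l, simpleCoroot M i v = 0 := by
  induction l with
  | nil => simp
  | cons a l ih =>
    rw [List.nodup_cons] at hnd
    rw [List.map_cons, List.prod_cons, map_mul, LinearEquiv.mul_apply,
      reflectionRep_simple_apply] at hv
    have h0 : simpleCoroot M a (reflectionRep cs (l.map cs.simple).prod v) = 0 := by
      have h := congrFun (congrArg Prod.fst hv) a
      simpa [simpleRoot, reflectionRep_prod_apply_fst_of_notMem cs hnd.1] using h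
    rw [h0, zero_smul, sub_zero] at hv
    rw [hv] at h0
    exact List.forall_mem_cons.mpr ⟨h0, ih hnd.2 hv⟩

/-- **Theorem 3.1.** Every Coxeter element, i.e. the product of the simple
reflections of `W` taken in any linear order (each exactly once), is essential. -/
theorem coxeterElement_isEssential [Fintype B] {M : CoxeterMatrix B} (cs : CoxeterSystem M W)
    (l : List B) (hnd : l.Nodup) (hall : ∀ s : B, s ∈ l) :
    IsEssential cs (l.map cs.simple).prod := by
  classical
  rintro P ⟨w, X, rfl⟩ hP hc
  obtain ⟨s, hs⟩ : ∃ s, s ∉ X := by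
    by_contra! hX
    refine hP ?_
    rw [standardParabolic, Set.eq_univ_of_forall hX, Set.image_univ,
      cs.subgroup_closure_range_simple]
    exact Subgroup.map_top_of_surjective _ (MulAut.conj w).surjective
  obtain ⟨x, hx, hxc⟩ := hc
  let v : (B → ℝ) × (B → ℝ) := (0, Pi.single s 1)
  have hv (i : B) : simpleCoroot M i v = if i = s then 1 else 0 := by
    simp [simpleCoroot, v, Pi.single_apply]
  have hxv : reflectionRep cs x v = v :=
    reflectionRep_apply_eq_self cs
      (fun i hi ↦ by rw [hv, if_neg (ne_of_mem_of_not_mem hi hs)]) hx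
  have hcv : reflectionRep cs (l.map cs.simple).prod (reflectionRep cs w v) =
      reflectionRep cs w v := by
    rw [← hxc, ← LinearEquiv.mul_apply, ← map_mul]
    simp [hxv]
  have hwv := simpleCoroot_eq_zero_of_reflectionRep_prod_apply_eq_self cs hnd hcv
  have hfix : reflectionRep cs w⁻¹ (reflectionRep cs w v) = reflectionRep cs w v := by
    refine reflectionRep_apply_eq_self cs (X := Set.univ) (fun i _ ↦ hwv i (hall i)) ?_
    rw [standardParabolic, Set.image_univ, cs.subgroup_closure_range_simple]
    trivial
  rw [← LinearEquiv.mul_apply, ← map_mul, inv_mul_cancel, map_one, LinearEquiv.coe_one, id_eq]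
    at hfix
  have h := hwv s (hall s)
  rw [← hfix, hv, if_pos rfl] at h
  exact one_ne_zero h

end CoxeterPaper
end
end

section
/- Let (W,S) be an irreducible Coxeter system with W infinite. Then W is indecomposable: if A and B are subgroups of W such that W is the internal direct product A × B, then A = {1} or B = {1}. -/
/-!
Statement 12 (Theorem 4.1.1): Let (W,S) be an irreducible Coxeter system with W infinite.
Then W is indecomposable: if A and B are subgroups of W such that W is the internal direct
product A × B, then A = {1} or B = {1}.
-/

noncomputable section

namespace CoxeterPaper

variable {B : Type*} {W : Type*} [Group W]

/-- The Coxeter graph of `M`: vertex set `B`, with `s, t` joined by an edge iff `m_{s,t} ≥ 3`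
(where `m_{s,t} = ∞` is encoded by `M s t = 0`). -/
def coxeterGraph (M : CoxeterMatrix B) : SimpleGraph B :=
  SimpleGraph.fromRel (fun s t => M s t = 0 ∨ 3 ≤ M s t)

/-- If `t` is a right descent of `w` and `s` is not, then `w` factors as `v * u`, with lengths
adding up, where `u` is an alternating word in `s` and `t` shorter than the braid word and `v` has
neither `s` nor `t` as a right descent. -/
lemma exists_eq_mul_alternatingWord {M : CoxeterMatrix B} (cs : CoxeterSystem M W) {w : W}
    {s t : B} (hs : ¬cs.IsRightDescent w s) (ht : cs.IsRightDescent w t) :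
    ∃ (v : W) (n : ℕ), w = v * cs.wordProd (CoxeterSystem.alternatingWord s t n) ∧
      cs.length v < cs.length w ∧ (M s t ≠ 0 → n < M s t) ∧
      ¬cs.IsRightDescent v s ∧ ¬cs.IsRightDescent v t := by
  classical
  let P : ℕ → Prop := fun n => ∃ v : W,
    w = v * cs.wordProd (CoxeterSystem.alternatingWord s t n) ∧ cs.length v + n = cs.length w
  have hP1 : P 1 := ⟨w * cs.simple t, by simp [CoxeterSystem.alternatingWord],
    cs.isRightDescent_iff.1 ht⟩
  have hPle : ∀ n, P n → n ≤ cs.length w := fun n ⟨v, _, h⟩ => by omega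
  set n := Nat.findGreatest P (cs.length w) with hn
  have hPn : P n := Nat.findGreatest_spec (hPle 1 hP1) hP1
  have hn1 : 1 ≤ n := Nat.le_findGreatest (hPle 1 hP1) hP1
  have hmax : ¬P (n + 1) := fun h => by
    have := Nat.le_findGreatest (hPle _ h) h
    omega
  obtain ⟨v, hw, hlen⟩ := hPn
  have hnext : ¬cs.IsRightDescent v (if Even n then t else s) := fun hd => by
    refine hmax ⟨v * cs.simple (if Even n then t else s), ?_, ?_⟩
    · rw [CoxeterSystem.alternatingWord_succ', cs.wordProd_cons, mul_assoc,
        cs.simple_mul_simple_cancel_left, hw]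
    · have := cs.isRightDescent_iff.1 hd
      omega
  have hfirst : ¬cs.IsRightDescent v (if Even n then s else t) := fun hd => by
    obtain ⟨k, hk⟩ := Nat.exists_eq_add_of_le' hn1
    have hletter : (if Even n then s else t) = if Even k then t else s := by
      rw [hk]
      by_cases h : Even k <;> simp [h, Nat.even_add_one]
    rw [hletter] at hd
    have hw' : w = v * cs.simple (if Even k then t else s) *
        cs.wordProd (CoxeterSystem.alternatingWord s t k) := by
      rw [hw, hk, CoxeterSystem.alternatingWord_succ', cs.wordProd_cons, mul_assoc]
    have h1 := cs.length_mul_le (v * cs.simple (if Even k then t else s))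
      (cs.wordProd (CoxeterSystem.alternatingWord s t k))
    rw [← hw'] at h1
    have h2 := cs.length_wordProd_le (CoxeterSystem.alternatingWord s t k)
    rw [CoxeterSystem.length_alternatingWord] at h2
    have h3 := cs.isRightDescent_iff.1 hd
    omega
  refine ⟨v, n, hw, by omega, fun hM => ?_, ?_⟩
  · by_contra! hle
    have hred : cs.IsReduced (CoxeterSystem.alternatingWord s t n) := by
      have h1 := cs.length_mul_le v (cs.wordProd (CoxeterSystem.alternatingWord s t n))
      rw [← hw] at h1
      have h2 := cs.length_wordProd_le (CoxeterSystem.alternatingWord s t n)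
      rw [CoxeterSystem.IsReduced]
      rw [CoxeterSystem.length_alternatingWord] at h2 ⊢
      omega
    have hnM : n = M s t := by
      by_contra hne
      exact cs.not_isReduced_alternatingWord s t hM (by omega) hred
    obtain ⟨k, hk⟩ := Nat.exists_eq_add_of_le' hn1
    have hbraid := cs.wordProd_braidWord_eq s t
    rw [CoxeterSystem.braidWord, CoxeterSystem.braidWord, M.symmetric t s, ← hnM] at hbraid
    have hws : w * cs.simple s = v * cs.wordProd (CoxeterSystem.alternatingWord s t k) := by
      rw [hw, hbraid, hk, CoxeterSystem.alternatingWord_succ, cs.wordProd_concat, ← mul_assoc,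
        cs.simple_mul_simple_cancel_right]
    have h1 := cs.length_mul_le v (cs.wordProd (CoxeterSystem.alternatingWord s t k))
    have h2 := cs.length_wordProd_le (CoxeterSystem.alternatingWord s t k)
    rw [CoxeterSystem.length_alternatingWord] at h2
    have h3 := cs.not_isRightDescent_iff.1 hs
    rw [hws] at h3
    omega
  · by_cases h : Even n
    · simp only [h, if_true] at hnext hfirst
      exact ⟨hfirst, hnext⟩
    · simp only [h, if_false] at hnext hfirst
      exact ⟨hnext, hfirst⟩

section Representation

open Real Module

variable [DecidableEq B]

/-- The simple root indexed by `s`. -/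
abbrev root (s : B) : B → ℝ := Pi.single s 1

lemma root_pos (s : B) : 0 < root s := by simp [root]

variable [Fintype B]

/-- The canonical symmetric bilinear form attached to a Coxeter matrix, for which
`⟪α s, α t⟫ = -cos (π / M s t)`; when `M s t = 0` (encoding `∞`) this value is `-1`. -/
def form (M : CoxeterMatrix B) : LinearMap.BilinForm ℝ (B → ℝ) :=
  Matrix.toBilin' (Matrix.of fun s t => -cos (π / M s t))

lemma form_root_root (M : CoxeterMatrix B) (s t : B) :
    form M (root s) (root t) = -cos (π / M s t) := by
  simp [form, root]

lemma form_root_self (M : CoxeterMatrix B) (s : B) : form M (root s) (root s) = 1 := by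
  simp [form_root_root]

lemma form_comm (M : CoxeterMatrix B) (x y : B → ℝ) : form M x y = form M y x := by
  simp only [form, Matrix.toBilin'_apply, Matrix.of_apply]
  rw [Finset.sum_comm]
  refine Finset.sum_congr rfl fun i _ => Finset.sum_congr rfl fun j _ => ?_
  rw [M.symmetric]
  ring

/-- The coroot of the simple root indexed by `s`. -/
def coroot (M : CoxeterMatrix B) (s : B) : Dual ℝ (B → ℝ) := (2 : ℝ) • form M (root s)

lemma coroot_apply (M : CoxeterMatrix B) (s : B) (x : B → ℝ) :
    coroot M s x = 2 * form M (root s) x := by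
  simp [coroot]

lemma coroot_root_self (M : CoxeterMatrix B) (s : B) : coroot M s (root s) = 2 := by
  rw [coroot_apply, form_root_self, mul_one]

/-- The simple reflection of the geometric representation. -/
def simpleReflection (M : CoxeterMatrix B) (s : B) : (B → ℝ) ≃ₗ[ℝ] (B → ℝ) :=
  reflection (coroot_root_self M s)

lemma simpleReflection_apply (M : CoxeterMatrix B) (s : B) (x : B → ℝ) :
    simpleReflection M s x = x - (2 * form M (root s) x) • root s := by
  rw [simpleReflection, reflection_apply, coroot_apply]

lemma isLiftable_simpleReflection (M : CoxeterMatrix B) :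
    M.IsLiftable (simpleReflection M) := by
  intro s t
  obtain rfl | hst := eq_or_ne s t
  · ext1 x
    simp [simpleReflection, involutive_reflection (coroot_root_self M s) x]
  have h1 : M s t ≠ 1 := M.off_diagonal s t hst
  generalize hm : M s t = m at h1
  have hf : form M (root s) (root t) = -cos (π / m) := by rw [form_root_root, hm]
  have hf' : form M (root t) (root s) = -cos (π / m) := by rw [form_comm, hf]
  obtain rfl | rfl | hm3 : m = 0 ∨ m = 2 ∨ 3 ≤ m := by omega
  · simp
  · ext1 x
    simp only [Nat.cast_ofNat, cos_pi_div_two, neg_zero] at hf hf'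
    simp only [pow_two, LinearEquiv.mul_apply, simpleReflection_apply, map_sub, map_smul, hf, hf',
      form_root_self, LinearEquiv.coe_one, id]
    module
  · ext1 z
    have hm0 : (0 : ℝ) < m := by positivity
    set θ : ℝ := π / m with hθ
    have hθm : m * θ = π := by rw [hθ]; field_simp
    have hsin : sin (2 * θ) ≠ 0 := by
      refine (sin_pos_of_pos_of_lt_pi (by positivity) ?_).ne'
      have : (3 : ℝ) ≤ m := by exact_mod_cast hm3
      have : 0 < θ := by positivity
      nlinarith
    have ht : 2 * cos (2 * θ) = coroot M s (root t) * coroot M t (root s) - 2 := by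
      rw [coroot_apply, coroot_apply, hf, hf', cos_two_mul]
      ring
    have hS (n : ℤ) : (Polynomial.Chebyshev.S ℝ n).eval (2 * cos (2 * θ)) =
        sin ((n + 1) * (2 * θ)) / sin (2 * θ) := by
      rw [← Polynomial.Chebyshev.S_two_mul_real_cos, mul_div_cancel_right₀ _ hsin]
    rw [simpleReflection, simpleReflection,
      reflection_mul_reflection_pow_apply _ _ m z _ ht]
    obtain ⟨k, rfl | rfl⟩ := m.even_or_odd'
    · have h0 : (Polynomial.Chebyshev.S ℝ ((k : ℤ) - 1)).eval (2 * cos (2 * θ)) = 0 := by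
        have : ((((k : ℤ) - 1 : ℤ) : ℝ) + 1) * (2 * θ) = π := by
          rw [← hθm]; push_cast; ring
        rw [hS, this, sin_pi, zero_div]
      rw [show (((2 * k : ℕ) : ℤ) - 2) / 2 = k - 1 by omega,
        show (((2 * k : ℕ) : ℤ) - 1) / 2 = k - 1 by omega, h0]
      simp
    · have h0 : (Polynomial.Chebyshev.S ℝ (k : ℤ)).eval (2 * cos (2 * θ)) +
          (Polynomial.Chebyshev.S ℝ ((k : ℤ) - 1)).eval (2 * cos (2 * θ)) = 0 := by
        have e : ((k : ℝ) + 1) * (2 * θ) = 2 * π - k * (2 * θ) + 0 := by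
          rw [← hθm]; push_cast; ring
        rw [hS, hS]
        push_cast
        rw [e, add_zero, sin_two_pi_sub, sub_add_cancel]
        ring
      rw [show (((2 * k + 1 : ℕ) : ℤ) - 2) / 2 = k - 1 by omega,
        show (((2 * k + 1 : ℕ) : ℤ) - 1) / 2 = k by omega,
        show (((2 * k + 1 : ℕ) : ℤ) - 3) / 2 = k - 1 by omega,
        show (((2 * k + 1 : ℕ) : ℤ)) / 2 = k by omega, h0]
      simp

variable {M : CoxeterMatrix B} (cs : CoxeterSystem M W)

/-- The geometric (Tits) representation of a Coxeter group. -/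
def geomRep : W →* ((B → ℝ) ≃ₗ[ℝ] (B → ℝ)) :=
  cs.lift ⟨simpleReflection M, isLiftable_simpleReflection M⟩

lemma geomRep_simple (s : B) (x : B → ℝ) :
    geomRep cs (cs.simple s) x = x - (2 * form M (root s) x) • root s := by
  rw [geomRep, cs.lift_apply_simple, simpleReflection_apply]

lemma geomRep_simple_root_self (s : B) : geomRep cs (cs.simple s) (root s) = -root s := by
  rw [geomRep_simple, form_root_self]
  module

lemma geomRep_mul_apply (v w : W) (x : B → ℝ) :
    geomRep cs (v * w) x = geomRep cs v (geomRep cs w x) := by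
  rw [map_mul, LinearEquiv.mul_apply]

lemma form_geomRep (w : W) (x y : B → ℝ) :
    form M (geomRep cs w x) (geomRep cs w y) = form M x y := by
  induction w using cs.simple_induction_left generalizing x y with
  | one => simp
  | mul_simple_left w s ih =>
    rw [geomRep_mul_apply, geomRep_mul_apply, ← ih x y, geomRep_simple, geomRep_simple]
    simp only [map_sub, map_smul, LinearMap.sub_apply, LinearMap.smul_apply, form_root_self,
      smul_eq_mul, form_comm M _ (root s)]
    ring

/-! ### Positivity of roots -/

lemma geomRep_alternatingWord_root (s t : B) (n : ℕ) :
    geomRep cs (cs.wordProd (CoxeterSystem.alternatingWord s t n)) (root s) =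
      if Even n then
        (Polynomial.Chebyshev.S ℝ n).eval (2 * cos (π / M s t)) • root s +
          (Polynomial.Chebyshev.S ℝ (n - 1)).eval (2 * cos (π / M s t)) • root t
      else
        (Polynomial.Chebyshev.S ℝ (n - 1)).eval (2 * cos (π / M s t)) • root s +
          (Polynomial.Chebyshev.S ℝ n).eval (2 * cos (π / M s t)) • root t := by
  have hf : form M (root s) (root t) = -cos (π / M s t) := form_root_root M s t
  have hf' : form M (root t) (root s) = -cos (π / M s t) := by rw [form_comm, hf]
  induction n with
  | zero => simp [CoxeterSystem.alternatingWord]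
  | succ n ih =>
    rw [CoxeterSystem.alternatingWord_succ', cs.wordProd_cons, geomRep_mul_apply, ih]
    have hS := Polynomial.Chebyshev.S_add_one ℝ n
    by_cases h : Even n
    · have h' : ¬ Even (n + 1) := by simpa [Nat.even_add_one] using h
      simp only [h, h', if_true, if_false, geomRep_simple, map_add, map_smul, hf', form_root_self]
      push_cast
      rw [add_sub_cancel_right, hS]
      simp only [Polynomial.eval_sub, Polynomial.eval_mul, Polynomial.eval_X]
      module
    · have h' : Even (n + 1) := by simpa [Nat.even_add_one] using h
      simp only [h, h', if_true, if_false, geomRep_simple, map_add, map_smul, hf, form_root_self]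
      push_cast
      rw [add_sub_cancel_right, hS]
      simp only [Polynomial.eval_sub, Polynomial.eval_mul, Polynomial.eval_X]
      module

lemma eval_S_two_mul_cos_pi_div_nonneg {m n : ℕ} (hm : m ≠ 1) (hn : m ≠ 0 → n ≤ m) :
    0 ≤ (Polynomial.Chebyshev.S ℝ (n - 1)).eval (2 * cos (π / m)) := by
  obtain rfl | hm0 := eq_or_ne m 0
  · simp [Polynomial.Chebyshev.S_eval_two]
  have hm2 : (2 : ℝ) ≤ m := by exact_mod_cast (by omega : 2 ≤ m)
  have hn' : (n : ℝ) ≤ m := by exact_mod_cast hn hm0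
  have hsin : 0 < sin (π / m) :=
    sin_pos_of_pos_of_lt_pi (by positivity) (div_lt_self pi_pos (by linarith))
  refine nonneg_of_mul_nonneg_left ?_ hsin
  rw [Polynomial.Chebyshev.S_two_mul_real_cos]
  push_cast
  rw [sub_add_cancel]
  refine sin_nonneg_of_nonneg_of_le_pi (by positivity) ?_
  rw [mul_div_assoc', div_le_iff₀ (by linarith), mul_comm π]
  exact mul_le_mul_of_nonneg_right hn' pi_pos.le

lemma geomRep_alternatingWord_root_eq_nonneg {s t : B} (hst : s ≠ t) {n : ℕ}
    (hn : M s t ≠ 0 → n < M s t) :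
    ∃ c d : ℝ, 0 ≤ c ∧ 0 ≤ d ∧
      geomRep cs (cs.wordProd (CoxeterSystem.alternatingWord s t n)) (root s) =
        c • root s + d • root t := by
  have h1 := eval_S_two_mul_cos_pi_div_nonneg (M.off_diagonal s t hst) fun h => (hn h).le
  have h2 := eval_S_two_mul_cos_pi_div_nonneg (n := n + 1) (M.off_diagonal s t hst) hn
  push_cast at h2
  rw [add_sub_cancel_right] at h2
  rw [geomRep_alternatingWord_root]
  split_ifs
  exacts [⟨_, _, h2, h1, rfl⟩, ⟨_, _, h1, h2, rfl⟩]

theorem geomRep_root_nonneg (w : W) (s : B) (hs : ¬cs.IsRightDescent w s) :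
    0 ≤ geomRep cs w (root s) := by
  induction hl : cs.length w using Nat.strong_induction_on generalizing w s with
  | _ l ih =>
  subst hl
  by_cases hw : w = 1
  · subst hw
    simp [root]
  obtain ⟨t, ht⟩ := cs.exists_rightDescent_of_ne_one hw
  have hst : s ≠ t := by
    rintro rfl
    exact hs ht
  obtain ⟨v, n, hwv, hlen, hn, hvs, hvt⟩ := exists_eq_mul_alternatingWord cs hs ht
  obtain ⟨c, d, hc, hd, hcd⟩ := geomRep_alternatingWord_root_eq_nonneg cs hst hn
  rw [hwv, geomRep_mul_apply, hcd, map_add, map_smul, map_smul]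
  exact add_nonneg (smul_nonneg hc (ih _ hlen v s hvs rfl)) (smul_nonneg hd (ih _ hlen v t hvt rfl))

theorem geomRep_root_nonpos (w : W) (s : B) (hs : cs.IsRightDescent w s) :
    geomRep cs w (root s) ≤ 0 := by
  have h := geomRep_root_nonneg cs (w * cs.simple s) s
    (cs.isRightDescent_iff_not_isRightDescent_mul.1 hs)
  rwa [geomRep_mul_apply, geomRep_simple_root_self, map_neg, neg_nonneg] at h

/-- The geometric representation is faithful. -/
theorem geomRep_eq_one {w : W} (hw : geomRep cs w = 1) : w = 1 := by
  by_contra h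
  obtain ⟨s, hs⟩ := cs.exists_rightDescent_of_ne_one h
  have := geomRep_root_nonpos cs w s hs
  rw [hw] at this
  exact (root_pos s).not_ge this

/-- If some element of the Coxeter group acts as `-1`, the group is finite. -/
theorem finite_of_geomRep_eq_neg {k : W} (hk : ∀ x, geomRep cs k x = -x) : Finite W := by
  have hlen : ∀ w : W, cs.length (k * w) + cs.length w = cs.length k := by
    intro w
    induction hl : cs.length w using Nat.strong_induction_on generalizing w with
    | _ l ih =>
    subst hl
    by_cases hw : w = 1
    · simp [hw]
    obtain ⟨s, hs⟩ := cs.exists_rightDescent_of_ne_one hw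
    have hkw : ¬cs.IsRightDescent (k * w) s := fun h => by
      have h1 := geomRep_root_nonpos cs w s hs
      have h2 := geomRep_root_nonpos cs (k * w) s h
      rw [geomRep_mul_apply, hk, neg_nonpos] at h2
      have h3 := (geomRep cs w).map_eq_zero_iff.1 (le_antisymm h1 h2)
      exact (root_pos s).ne' h3
    have h1 := cs.isRightDescent_iff.1 hs
    have h2 := cs.not_isRightDescent_iff.1 hkw
    have h3 := ih _ (by omega) (w * cs.simple s) rfl
    rw [← mul_assoc] at h3
    omega
  have : Finite {l : List B // l.length ≤ cs.length k} :=
    (List.finite_length_le B (cs.length k)).to_subtype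
  refine Finite.of_surjective (fun l : {l : List B // l.length ≤ cs.length k} => cs.wordProd l) ?_
  intro w
  obtain ⟨l, hl, rfl⟩ := cs.exists_isReduced w
  refine ⟨⟨l, ?_⟩, rfl⟩
  rw [← hl.eq, ← hlen (cs.wordProd l)]
  omega

end Representation

section Components

variable {V G : Type*} [AddCommGroup V] [Module ℝ V] [Group G]

/-- Let `α` be a unit vector whose orbit under a group `G` of isometries spans, and suppose that
`G` fixes the radical of the form. If the reflection in `α` is the product of involutions `a ∈ A`
and `k ∈ K`, where `A` and `K` commute and generate `G`, and `a` fixes `α`, then `a = 1` or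
`k = -1`. -/
theorem eq_one_or_eq_neg_of_reflection_eq_mul {ρ : G →* (V ≃ₗ[ℝ] V)} {φ : LinearMap.BilinForm ℝ V}
    (hφ : ∀ x y, φ x y = φ y x) (hρ : ∀ g x y, φ (ρ g x) (ρ g y) = φ x y)
    {α : V} (hα : φ α α = 1) (hspan : ∀ p : Submodule ℝ V, (∀ g, ρ g α ∈ p) → p = ⊤)
    (hrad : ∀ u, (∀ x, φ u x = 0) → ∀ g, ρ g u = u)
    {A K : Subgroup G} (hcomm : ∀ g ∈ A, ∀ h ∈ K, ∀ x, ρ g (ρ h x) = ρ h (ρ g x))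
    (hprod : ∀ g : G, ∃ a ∈ A, ∃ k ∈ K, g = a * k) {a k : G} (ha : a ∈ A) (hk : k ∈ K)
    (hk2 : ∀ x, ρ k (ρ k x) = x)
    (hrefl : ∀ x, ρ a (ρ k x) = x - (2 * φ α x) • α) (haα : ρ a α = α) :
    (∀ x, ρ a x = x) ∨ ∀ x, ρ k x = -x := by
  have : IsAddTorsionFree V := .of_isTorsionFree ℝ V
  have hspan' : ∀ p : Submodule ℝ V, (∀ g ∈ A, ∀ h ∈ K, ρ g (ρ h α) ∈ p) → ∀ x, x ∈ p := by
    intro p hp x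
    rw [hspan p fun g => ?_]
    · trivial
    · obtain ⟨a, ha, k, hk, rfl⟩ := hprod g
      simpa using hp a ha k hk
  have hak : ∀ x, ρ a x = ρ k x - (2 * φ α (ρ k x)) • α := fun x => by
    rw [← hrefl, hk2]
  have hkα : ρ k α = -α := by
    have h := hrefl α
    rw [hcomm a ha k hk, haα, hα] at h
    rw [h]
    module
  -- The `A`-orbit of `α` is negated by `k` and the `K`-orbit of `α` is fixed by `a`.
  have hkA : ∀ g ∈ A, ρ k (ρ g α) = -ρ g α := fun g hg => by
    rw [← hcomm g hg k hk, hkα, map_neg]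
  have haK : ∀ h ∈ K, ρ a (ρ h α) = ρ h α := fun h hh => by
    rw [hcomm a ha h hh, haα]
  by_cases hA : ∀ g ∈ A, ∃ c : ℝ, ρ g α = c • α
  · left
    refine hspan' (LinearMap.eqLocus (ρ a).toLinearMap LinearMap.id) fun g hg h hh => ?_
    obtain ⟨c, hc⟩ := hA g hg
    simp only [LinearMap.mem_eqLocus, LinearEquiv.coe_coe, LinearMap.id_apply]
    rw [hcomm g hg h hh, hc, map_smul, map_smul, haK h hh]
  by_cases hK : ∀ h ∈ K, ∃ c : ℝ, ρ h α = c • α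
  · right
    refine hspan' (LinearMap.eqLocus (ρ k).toLinearMap (-LinearMap.id)) fun g hg h hh => ?_
    obtain ⟨c, hc⟩ := hK h hh
    simp only [LinearMap.mem_eqLocus, LinearEquiv.coe_coe, LinearMap.neg_apply,
      LinearMap.id_apply]
    rw [hc, map_smul, map_smul, hkA g hg, smul_neg]
  exfalso
  push Not at hA hK
  obtain ⟨g₀, hg₀, hg₀α⟩ := hA
  obtain ⟨h₀, hh₀, hh₀α⟩ := hK
  -- `c g` is the `α`-coordinate of `g α`, and `u g` its component orthogonal to `α`.
  let c : G → ℝ := fun g => φ α (ρ g α)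
  let u : G → V := fun g => ρ g α - c g • α
  have hdecomp : ∀ g, ρ g α = c g • α + u g := fun g => by simp [u]
  have huα : ∀ g, φ α (u g) = 0 := fun g => by simp [u, c, hα]
  have hkuA : ∀ g ∈ A, ρ k (u g) = -u g := fun g hg => by
    simp only [u, map_sub, map_smul, hkA g hg, hkα]
    module
  have hauA : ∀ g ∈ A, ρ a (u g) = -u g := fun g hg => by
    rw [hak, hkuA g hg, map_neg, huα]
    simp
  have hauK : ∀ h ∈ K, ρ a (u h) = u h := fun h hh => by
    simp only [u, map_sub, map_smul, haK h hh, haα]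
  have hkuK : ∀ h ∈ K, ρ k (u h) = u h := fun h hh => by
    have h1 := hrefl (u h)
    rw [hcomm a ha k hk, hauK h hh, huα] at h1
    simpa using h1
  have key : ∀ g ∈ A, ∀ h ∈ K, ρ h (u g) = c h • u g ∧ ρ g (u h) = c g • u h := by
    intro g hg h hh
    have heq : ρ h (u g) - c h • u g = ρ g (u h) - c g • u h := by
      have e := hcomm g hg h hh α
      rw [hdecomp g, hdecomp h] at e
      simp only [map_add, map_smul] at e
      rw [hdecomp g, hdecomp h] at e
      linear_combination (norm := module) -e
    set x := ρ h (u g) - c h • u g with hx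
    have hax : ρ a x = -x := by
      rw [hx, map_sub, map_smul, hcomm a ha h hh, hauA g hg, map_neg]
      module
    have hkx : ρ k x = x := by
      rw [heq, map_sub, map_smul, ← hcomm g hg k hk, hkuK h hh]
    have hxα : x = φ α x • α := by
      have h1 := hrefl x
      rw [hkx, hax] at h1
      have h2 : (2 : ℝ) • x = (2 : ℝ) • (φ α x • α) := by
        linear_combination (norm := module) -h1
      exact smul_right_injective V (two_ne_zero (α := ℝ)) h2
    have hx0 : x = 0 := by
      have h1 : ρ a x = x := by rw [hxα, map_smul, haα]
      rw [hax] at h1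
      exact self_eq_neg.1 h1.symm
    exact ⟨sub_eq_zero.1 hx0, sub_eq_zero.1 (heq ▸ hx0)⟩
  have hcinv : ∀ g, c g⁻¹ = c g := fun g => by
    simp only [c]
    rw [← hρ g, hφ, ← LinearEquiv.mul_apply, ← map_mul]
    simp
  have hφu : ∀ g g', φ (u g) (u g') = c (g⁻¹ * g') - c g * c g' := fun g g' => by
    have h1 : φ (ρ g α) (ρ g' α) = c (g⁻¹ * g') := by
      simp only [c]
      rw [← hρ g α, ← LinearEquiv.mul_apply (ρ g), ← map_mul, mul_inv_cancel_left]
    have h2 : φ (ρ g α) α = c g := hφ _ _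
    simp only [u, map_sub, map_smul, LinearMap.sub_apply, LinearMap.smul_apply, smul_eq_mul, h1,
      h2, hα]
    simp only [c]
    ring
  -- If `H` acts on some nonzero vector through `c`, then `c` is multiplicative on `H`.
  have hisotropic : ∀ (H : Subgroup G) (v : V), v ≠ 0 → (∀ g ∈ H, ρ g v = c g • v) →
      ∀ g ∈ H, ∀ g' ∈ H, φ (u g) (u g') = 0 := by
    intro H v hv hH g hg g' hg'
    have hmul : c (g⁻¹ * g') • v = (c g * c g') • v := by
      rw [← hH _ (H.mul_mem (H.inv_mem hg) hg'), map_mul, LinearEquiv.mul_apply, hH g' hg',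
        map_smul, hH _ (H.inv_mem hg), hcinv, smul_smul, mul_comm]
    rw [hφu, smul_left_injective ℝ hv hmul, sub_self]
  have hug₀ : u g₀ ≠ 0 := fun h => hg₀α (c g₀) (sub_eq_zero.1 h)
  have huh₀ : u h₀ ≠ 0 := fun h => hh₀α (c h₀) (sub_eq_zero.1 h)
  have hAA := hisotropic A (u h₀) huh₀ fun g hg => (key g hg h₀ hh₀).2
  have hAK : ∀ g ∈ A, ∀ h ∈ K, φ (u g) (u h) = 0 := fun g hg h hh => by
    have h1 := hρ a (u g) (u h)
    rw [hauA g hg, hauK h hh, map_neg, LinearMap.neg_apply] at h1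
    linarith
  have hradical : ∀ x, φ (u g₀) x = 0 := by
    refine hspan' (LinearMap.ker (φ (u g₀))) fun g hg h hh => ?_
    rw [LinearMap.mem_ker, hdecomp h, map_add, map_smul, (key g hg h hh).2, hdecomp g]
    simp only [map_add, map_smul, hAA g₀ hg₀ g hg, hAK g₀ hg₀ h hh, hφ _ α, huα]
    simp
  have h1 := hrad _ hradical a
  rw [hauA g₀ hg₀] at h1
  exact hug₀ (self_eq_neg.1 h1.symm)

end Components

section Irreducible

variable [Fintype B] [DecidableEq B] {M : CoxeterMatrix B} (cs : CoxeterSystem M W)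

lemma form_root_ne_zero_of_adj {s t : B} (h : (coxeterGraph M).Adj s t) :
    form M (root s) (root t) ≠ 0 := by
  have hm : M s t = 0 ∨ 3 ≤ M s t := by
    rw [coxeterGraph, SimpleGraph.fromRel_adj, M.symmetric t s, or_self] at h
    exact h.2
  rw [form_root_root, neg_ne_zero]
  obtain hm | hm := hm
  · simp [hm]
  · have hm' : (3 : ℝ) ≤ M s t := by exact_mod_cast hm
    have : 0 < Real.pi / M s t := by positivity
    refine (Real.cos_pos_of_mem_Ioo ⟨by linarith [Real.pi_pos], ?_⟩).ne'
    exact div_lt_div_of_pos_left Real.pi_pos two_pos (by linarith)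

lemma not_commute_of_adj {s t : B} (h : (coxeterGraph M).Adj s t) :
    ¬Commute (cs.simple s) (cs.simple t) := fun hc => by
  have e : geomRep cs (cs.simple s * cs.simple t) (root s) =
      geomRep cs (cs.simple t * cs.simple s) (root s) := by rw [hc.eq]
  simp only [geomRep_mul_apply, geomRep_simple, map_sub, map_smul, form_root_self,
    form_comm M (root t) (root s)] at e
  have e' := congrFun e t
  have hst : t ≠ s := h.ne'
  have := form_root_ne_zero_of_adj h
  simp [root, hst] at e'
  exact this (by linarith)

lemma span_orbit_root (hirr : (coxeterGraph M).Connected) (s : B) (p : Submodule ℝ (B → ℝ))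
    (hp : ∀ w, geomRep cs w (root s) ∈ p) : p = ⊤ := by
  have hroot : ∀ t, ∀ w, geomRep cs w (root t) ∈ p := by
    intro t
    obtain ⟨q⟩ := hirr.preconnected t s
    induction q with
    | nil => exact hp
    | @cons t t' _ h _ ih =>
      intro w
      have hne : 2 * form M (root t) (root t') ≠ 0 :=
        mul_ne_zero two_ne_zero (form_root_ne_zero_of_adj h)
      have h1 := p.sub_mem (ih hp w) (ih hp (w * cs.simple t))
      rw [geomRep_mul_apply, geomRep_simple, map_sub, map_smul, sub_sub_cancel] at h1
      exact (p.smul_mem_iff hne).1 h1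
  rw [eq_top_iff, ← (Pi.basisFun ℝ B).span_eq, Submodule.span_le]
  rintro _ ⟨t, rfl⟩
  simpa using hroot t 1

lemma geomRep_eq_self_of_mem_radical {u : B → ℝ} (hu : ∀ x, form M u x = 0) (w : W) :
    geomRep cs w u = u := by
  induction w using cs.simple_induction_left with
  | one => simp
  | mul_simple_left w s ih => rw [geomRep_mul_apply, ih, geomRep_simple, form_comm, hu]; simp

lemma commute_of_inf_eq_bot {A K : Subgroup W} (hA : A.Normal) (hK : K.Normal)
    (hinter : A ⊓ K = ⊥) {a k : W} (ha : a ∈ A) (hk : k ∈ K) : Commute a k :=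
  Subgroup.commute_of_normal_of_disjoint A K hA hK (disjoint_iff.2 hinter) a k ha hk

lemma simple_mem_of_eq_mul (hirr : (coxeterGraph M).Connected) (hinf : Infinite W)
    {A K : Subgroup W} (hA : A.Normal) (hK : K.Normal) (hinter : A ⊓ K = ⊥)
    (hprod : ∀ g : W, ∃ a ∈ A, ∃ k ∈ K, g = a * k) {s : B} {a k : W} (ha : a ∈ A) (hk : k ∈ K)
    (hs : cs.simple s = a * k) (hk2 : k * k = 1) (haα : geomRep cs a (root s) = root s) :
    cs.simple s ∈ K := by
  obtain h | h := eq_one_or_eq_neg_of_reflection_eq_mul (form_comm M) (form_geomRep cs)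
    (form_root_self M s) (span_orbit_root cs hirr s)
    (fun u hu w => geomRep_eq_self_of_mem_radical cs hu w)
    (fun g hg h hh x => by
      rw [← geomRep_mul_apply, (commute_of_inf_eq_bot hA hK hinter hg hh).eq, geomRep_mul_apply])
    hprod ha hk (fun x => by rw [← geomRep_mul_apply, hk2]; simp)
    (fun x => by rw [← geomRep_mul_apply, ← hs, geomRep_simple]) haα
  · rwa [hs, geomRep_eq_one cs (LinearEquiv.ext h), one_mul]
  · exact absurd (finite_of_geomRep_eq_neg cs h) (not_finite_iff_infinite.2 hinf)

lemma geomRep_root_eq_or_eq_neg {a : W} {s : B} (hc : Commute a (cs.simple s)) :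
    geomRep cs a (root s) = root s ∨ geomRep cs a (root s) = -root s := by
  obtain ⟨r, hr⟩ : ∃ r : ℝ, geomRep cs a (root s) = r • root s := by
    have e : geomRep cs (a * cs.simple s) (root s) = geomRep cs (cs.simple s * a) (root s) := by
      rw [hc.eq]
    rw [geomRep_mul_apply, geomRep_mul_apply, geomRep_simple_root_self, map_neg,
      geomRep_simple] at e
    refine ⟨form M (root s) (geomRep cs a (root s)), ?_⟩
    refine smul_right_injective _ (two_ne_zero (α := ℝ)) ?_
    simp only
    linear_combination (norm := module) -e
  have hform := form_geomRep cs a (root s) (root s)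
  rw [hr] at hform
  simp only [map_smul, LinearMap.smul_apply, form_root_self, smul_eq_mul, mul_one] at hform
  obtain rfl | rfl := mul_self_eq_one_iff.1 hform
  · left; simpa using hr
  · right; simpa using hr

/-- In a direct product decomposition of an infinite irreducible Coxeter group, every simple
reflection lies in one of the factors. -/
theorem simple_mem_or_mem (hirr : (coxeterGraph M).Connected) (hinf : Infinite W)
    {A K : Subgroup W} (hA : A.Normal) (hK : K.Normal) (hinter : A ⊓ K = ⊥)
    (hprod : ∀ g : W, ∃ a ∈ A, ∃ k ∈ K, g = a * k) (s : B) :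
    cs.simple s ∈ A ∨ cs.simple s ∈ K := by
  obtain ⟨a, ha, k, hk, hs⟩ := hprod (cs.simple s)
  have hak := commute_of_inf_eq_bot hA hK hinter ha hk
  have hsq : (a * a) * (k * k) = 1 := by
    rw [← cs.simple_mul_simple_self s, hs, mul_assoc, mul_assoc, ← mul_assoc k a k, ← hak.eq]
    group
  have hk2 : k * k = 1 := by
    have h : k * k ∈ A ⊓ K :=
      ⟨eq_inv_of_mul_eq_one_right hsq ▸ A.inv_mem (A.mul_mem ha ha), K.mul_mem hk hk⟩
    rwa [hinter, Subgroup.mem_bot] at h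
  have ha2 : a * a = 1 := by rwa [hk2, mul_one] at hsq
  have hcs : Commute a (cs.simple s) := hs ▸ (Commute.refl a).mul_right hak
  obtain h | h := geomRep_root_eq_or_eq_neg cs hcs
  · exact .inr (simple_mem_of_eq_mul cs hirr hinf hA hK hinter hprod ha hk hs hk2 h)
  · refine .inl (simple_mem_of_eq_mul cs hirr hinf hK hA (inf_comm A K ▸ hinter) (fun g => ?_)
      hk ha (hs.trans hak.eq) ha2 ?_)
    · obtain ⟨a, ha, k, hk, rfl⟩ := hprod g
      exact ⟨k, hk, a, ha, (commute_of_inf_eq_bot hA hK hinter ha hk).eq⟩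
    · have e := geomRep_simple_root_self cs s
      rw [hs, hak.eq, geomRep_mul_apply, h, map_neg, neg_inj] at e
      exact e

lemma eq_bot_of_simple_mem (hirr : (coxeterGraph M).Connected)
    {A K : Subgroup W} (hA : A.Normal) (hK : K.Normal) (hinter : A ⊓ K = ⊥)
    (h : ∀ s, cs.simple s ∈ A ∨ cs.simple s ∈ K) {s : B} (hs : cs.simple s ∈ A) : K = ⊥ := by
  have hall : ∀ t, cs.simple t ∈ A := by
    intro t
    obtain ⟨q⟩ := hirr.preconnected t s
    induction q with
    | nil => exact hs
    | cons hadj _ ih =>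
      refine (h _).resolve_right fun hK' => ?_
      exact not_commute_of_adj cs hadj (commute_of_inf_eq_bot hA hK hinter (ih hs) hK').symm
  have htop : A = ⊤ := by
    rw [eq_top_iff, ← cs.subgroup_closure_range_simple, Subgroup.closure_le]
    rintro _ ⟨t, rfl⟩
    exact hall t
  rwa [htop, top_inf_eq] at hinter

end Irreducible

/-- **Theorem 4.1, part 1.** An infinite irreducible Coxeter group is
(directly) indecomposable: in any internal direct product decomposition `W = A × K`
(`A, K` normal, `A ⊓ K = {1}`, `A K = W`), one of the factors is trivial. -/
theorem irreducible_infinite_coxeter_indecomposable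
    [Fintype B] {M : CoxeterMatrix B} (cs : CoxeterSystem M W)
    (hirr : (coxeterGraph M).Connected) (hinf : Infinite W)
    (A K : Subgroup W) (hA : A.Normal) (hK : K.Normal) (hinter : A ⊓ K = ⊥)
    (hprod : ∀ g : W, ∃ a ∈ A, ∃ k ∈ K, g = a * k) :
    A = ⊥ ∨ K = ⊥ := by
  classical
  have h := simple_mem_or_mem cs hirr hinf hA hK hinter hprod
  obtain ⟨s⟩ := hirr.nonempty
  obtain hs | hs := h s
  · exact .inr (eq_bot_of_simple_mem cs hirr hA hK hinter h hs)
  · exact .inl (eq_bot_of_simple_mem cs hirr hK hA (inf_comm A K ▸ hinter)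
      (fun t => (h t).symm) hs)

end CoxeterPaper
end
end
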